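/- Let G be a 2-connected planar simple graph with Δ(G) ≥ 5 that contains none of the configurations (A1)–(A4), and let H be a component of the graph obtained from G by deleting all vertices of degree 2. If u is a vertex of H with d(u) = 4, then: if u has at least one neighbor in G of degree at most 7, then u has exactly 3 neighbors in H of H-degree at least 10 (n'_{10^+}(u) = 3); otherwise all 4 neighbors of u in H have H-degree at least 8 (n'_{8^+}(u) = 4). -/

import Mathlib

open SimpleGraph

/-- The degree of a vertex `v` of `G` (cardinality of its neighbor set). -/
noncomputable def deg {V : Type*} (G : SimpleGraph V) (v : V) : ℕ :=
  (G.neighborSet v).ncard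

/-- The maximum degree `Δ(G)` of a finite graph `G`. -/
noncomputable def maxDeg {V : Type*} [Fintype V] (G : SimpleGraph V) : ℕ :=
  Finset.univ.sup fun v => deg G v

/-- The number of neighbors of `u` in `G` whose degree is exactly `k`. -/
noncomputable def nDegEq {V : Type*} (G : SimpleGraph V) (u : V) (k : ℕ) : ℕ :=
  {w | w ∈ G.neighborSet u ∧ deg G w = k}.ncard

/-- The number of neighbors of `u` in `G` whose degree is at most `k`. -/
noncomputable def nDegLe {V : Type*} (G : SimpleGraph V) (u : V) (k : ℕ) : ℕ :=
  {w | w ∈ G.neighborSet u ∧ deg G w ≤ k}.ncard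

/-- The number of neighbors of `u` in `G` whose degree is at least `k`. -/
noncomputable def nDegGe {V : Type*} (G : SimpleGraph V) (u : V) (k : ℕ) : ℕ :=
  {w | w ∈ G.neighborSet u ∧ k ≤ deg G w}.ncard

/-- `H` is a minor of `G`: there is a family of pairwise disjoint connected branch sets
indexed by the vertices of `H`, with an edge of `G` between the branch sets of any two
adjacent vertices of `H`. -/
def IsMinorOf {W V : Type*} (H : SimpleGraph W) (G : SimpleGraph V) : Prop :=
  ∃ φ : W → Set V,
    (∀ w, (G.induce (φ w)).Connected) ∧
    (∀ w₁ w₂, w₁ ≠ w₂ → Disjoint (φ w₁) (φ w₂)) ∧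
    ∀ ⦃w₁ w₂⦄, H.Adj w₁ w₂ → ∃ a ∈ φ w₁, ∃ b ∈ φ w₂, G.Adj a b

/-- A graph is planar iff it can be embedded in the plane; by Wagner's theorem this is
equivalent to having neither a `K₅` nor a `K₃,₃` minor. -/
def IsPlanar {V : Type*} (G : SimpleGraph V) : Prop :=
  ¬ IsMinorOf (completeGraph (Fin 5)) G ∧
  ¬ IsMinorOf (completeBipartiteGraph (Fin 3) (Fin 3)) G

/-- A graph is 2-connected: it has at least 3 vertices and deleting any single vertex
leaves a connected graph. -/
def TwoConnected {V : Type*} [Fintype V] (G : SimpleGraph V) : Prop :=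
  3 ≤ Fintype.card V ∧ ∀ v : V, (G.induce {w | w ≠ v}).Connected

/-- A proper edge coloring: distinct edges sharing a vertex get different colors. -/
def ProperEdgeColoring {V α : Type*} (G : SimpleGraph V) (c : Sym2 V → α) : Prop :=
  ∀ e₁ ∈ G.edgeSet, ∀ e₂ ∈ G.edgeSet, e₁ ≠ e₂ → (∃ v, v ∈ e₁ ∧ v ∈ e₂) → c e₁ ≠ c e₂

/-- An acyclic edge coloring: a proper edge coloring with no bichromatic cycle. -/
def AcyclicEdgeColoring {V α : Type*} (G : SimpleGraph V) (c : Sym2 V → α) : Prop :=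
  ProperEdgeColoring G c ∧
  ∀ (v : V) (w : G.Walk v v), w.IsCycle →
    ¬ ∃ i j : α, ∀ e ∈ w.edges, c e = i ∨ c e = j

/-- Configuration (A₁): a path `u v w` with `d(v) = 2` and `d(u) ≤ 9`. -/
def ConfigA1 {V : Type*} (G : SimpleGraph V) : Prop :=
  ∃ u v w : V, G.Adj u v ∧ G.Adj v w ∧ u ≠ w ∧ deg G v = 2 ∧ deg G u ≤ 9

/-- Configuration (A₂). -/
def ConfigA2 {V : Type*} (G : SimpleGraph V) : Prop :=
  ∃ u : V, 1 ≤ nDegEq G u 2 ∧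
    ((deg G u : ℤ) - 7 ≤ (nDegLe G u 8 : ℤ) ∨
     ((nDegLe G u 8 : ℤ) = (deg G u : ℤ) - 8 ∧ (deg G u : ℤ) - 9 ≤ (nDegEq G u 2 : ℤ)))

/-- Configuration (A₃). -/
def ConfigA3 {V : Type*} (G : SimpleGraph V) : Prop :=
  ∃ u v : V, G.Adj u v ∧ deg G u = 3 ∧
    (deg G v ≤ 8 ∨
     (deg G v = 9 ∧ ∃ w, G.Adj u w ∧ G.Adj v w) ∨
     (deg G v = 10 ∧ 5 ≤ nDegLe G v 5 ∧
       ∃ w₁ w₂, w₁ ≠ w₂ ∧ G.Adj u w₁ ∧ G.Adj v w₁ ∧ G.Adj u w₂ ∧ G.Adj v w₂))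

/-- Configuration (A₄). -/
def ConfigA4 {V : Type*} (G : SimpleGraph V) : Prop :=
  (∃ v u v₂ v₃ v₄ : V,
     deg G v = 4 ∧
     G.Adj v u ∧ G.Adj v v₂ ∧ G.Adj v v₃ ∧ G.Adj v v₄ ∧
     ([u, v₂, v₃, v₄] : List V).Pairwise (· ≠ ·) ∧
     deg G u ≤ deg G v₂ ∧ deg G v₂ ≤ deg G v₃ ∧ deg G v₃ ≤ deg G v₄ ∧
     4 ≤ deg G u ∧ deg G u ≤ 7 ∧ deg G u + deg G v₂ ≤ 17) ∨
  (∃ v u v₂ v₃ v₄ v₅ : V,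
     deg G v = 5 ∧
     G.Adj v u ∧ G.Adj v v₂ ∧ G.Adj v v₃ ∧ G.Adj v v₄ ∧ G.Adj v v₅ ∧
     ([u, v₂, v₃, v₄, v₅] : List V).Pairwise (· ≠ ·) ∧
     deg G u ≤ deg G v₂ ∧ deg G v₂ ≤ deg G v₃ ∧ deg G v₃ ≤ deg G v₄ ∧
       deg G v₄ ≤ deg G v₅ ∧
     ((4 ≤ deg G u ∧ deg G u ≤ 6 ∧ deg G u + deg G v₂ + deg G v₃ ≤ 18) ∨
      (deg G u = 6 ∧ deg G v₂ = 6 ∧ deg G v₃ = 7 ∧ deg G v₄ = 7 ∧ deg G v₅ = 7 ∧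
        G.Adj u v₅)))

theorem Finset.exists_sorted_insert {α : Type*} [DecidableEq α] (f : α → ℕ) {s : Finset α}
    {n : ℕ} (hs : s.card = n + 1) :
    ∃ a t, a ∉ t ∧ s = insert a t ∧ t.card = n ∧ ∀ b ∈ t, f a ≤ f b := by
  obtain ⟨a, ha, hmin⟩ := s.exists_min_image f (Finset.card_pos.1 (by omega))
  exact ⟨a, s.erase a, Finset.notMem_erase a s, (Finset.insert_erase ha).symm,
    by rw [Finset.card_erase_of_mem ha, hs]; rfl, fun b hb => hmin b (Finset.mem_of_mem_erase hb)⟩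

theorem Set.exists_sorted_of_ncard_eq_four {α : Type*} (f : α → ℕ) {s : Set α}
    (hs : s.ncard = 4) :
    ∃ a b c d, s = {a, b, c, d} ∧ ([a, b, c, d] : List α).Pairwise (· ≠ ·) ∧
      f a ≤ f b ∧ f b ≤ f c ∧ f c ≤ f d := by
  classical
  have hfin : s.Finite := Set.finite_of_ncard_ne_zero (by omega)
  lift s to Finset α using hfin
  rw [Set.ncard_coe_finset] at hs
  obtain ⟨a, s₁, ha, rfl, h₁, hfa⟩ := Finset.exists_sorted_insert f hs
  obtain ⟨b, s₂, hb, rfl, h₂, hfb⟩ := Finset.exists_sorted_insert f h₁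
  obtain ⟨c, s₃, hc, rfl, h₃, hfc⟩ := Finset.exists_sorted_insert f h₂
  obtain ⟨d, rfl⟩ := Finset.card_eq_one.1 h₃
  refine ⟨a, b, c, d, by simp, ?_, hfa b (by simp), hfb c (by simp), hfc d (by simp)⟩
  simp_all

section

variable {V : Type*} [Fintype V] {G : SimpleGraph V}

theorem TwoConnected.deg_ne_one (h2 : TwoConnected G) (v : V) : deg G v ≠ 1 := by
  classical
  intro hv
  obtain ⟨u, hu⟩ := Set.ncard_eq_one.1 hv
  have huv : G.Adj v u := (Set.ext_iff.1 hu u).2 rfl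
  obtain ⟨w, hwv, hwu⟩ : ∃ w, w ≠ v ∧ w ≠ u := by
    have hcard : ({v, u} : Finset V).card < (Finset.univ : Finset V).card :=
      Finset.card_le_two.trans_lt (by rw [Finset.card_univ]; exact h2.1)
    obtain ⟨w, -, hw⟩ := Finset.exists_mem_notMem_of_card_lt_card hcard
    exact ⟨w, by simp_all, by simp_all⟩
  have : Nontrivial {w | w ≠ u} :=
    ⟨⟨v, huv.ne⟩, ⟨w, hwu⟩, fun h => hwv (congrArg Subtype.val h).symm⟩
  obtain ⟨x, hx⟩ := (h2.2 u).preconnected.exists_adj_of_nontrivial ⟨v, huv.ne⟩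
  exact x.2 ((Set.ext_iff.1 hu x).1 hx)

/-- Deleting the vertices of degree `2` lowers the degree of `v` by its number of neighbors of
degree `2`. -/
theorem deg_induce_add_nDegEq_two (v : {v : V | deg G v ≠ 2}) :
    deg (G.induce {v : V | deg G v ≠ 2}) v + nDegEq G v 2 = deg G v := by
  have himage : Subtype.val '' (G.induce {v : V | deg G v ≠ 2}).neighborSet v =
      G.neighborSet v \ {w | w ∈ G.neighborSet v ∧ deg G w = 2} := by
    ext w
    simp only [Set.mem_image, mem_neighborSet, comap_adj, Function.Embedding.subtype_apply,
      Set.mem_sdiff, Set.mem_ofPred_eq, Subtype.exists]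
    constructor
    · rintro ⟨x, hx, hvx, rfl⟩
      exact ⟨hvx, fun h => hx h.2⟩
    · rintro ⟨hvw, hw⟩
      exact ⟨w, fun h => hw ⟨hvw, h⟩, hvw, rfl⟩
  rw [deg, ← Set.ncard_image_of_injective _ Subtype.val_injective, himage]
  exact Set.ncard_sdiff_add_ncard_of_subset fun _ h => h.1

theorem nDegEq_two_eq_zero_of_deg_le_nine (hA1 : ¬ ConfigA1 G) {v : V} (hv : deg G v ≤ 9) :
    nDegEq G v 2 = 0 := by
  rw [nDegEq, Set.ncard_eq_zero]
  refine Set.eq_empty_of_forall_notMem fun w ⟨hvw, hw⟩ => hA1 ?_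
  obtain ⟨x, hx, hxv⟩ := Set.exists_ne_of_one_lt_ncard (s := G.neighborSet w)
    (by rw [← deg, hw]; decide) v
  exact ⟨v, w, x, hvw, hx, hxv.symm, hw, hv⟩

/-- The neighbor `u` of small degree other than `2` improves the bound that excluding `ConfigA2`
gives on the number of neighbors of degree `2`. -/
theorem nDegEq_two_add_ten_le (hA2 : ¬ ConfigA2 G) {u v : V} (huv : G.Adj v u)
    (hu : deg G u ≤ 8) (hu2 : deg G u ≠ 2) (hv : 1 ≤ nDegEq G v 2) :
    nDegEq G v 2 + 10 ≤ deg G v := by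
  have hlt : nDegEq G v 2 < nDegLe G v 8 := by
    refine Set.ncard_lt_ncard ⟨fun w hw => ⟨hw.1, by rw [hw.2]; decide⟩, fun h => ?_⟩
    exact hu2 (h (show u ∈ {w | w ∈ G.neighborSet v ∧ deg G w ≤ 8} from ⟨huv, hu⟩)).2
  have hnot := not_or.1 fun h => hA2 ⟨v, hv, h⟩
  omega

/-- A neighbor of a vertex of small degree other than `2` keeps its degree, or a degree of at
least `10`, when the vertices of degree `2` are deleted. -/
theorem deg_induce_eq_or_ten_le (hA2 : ¬ ConfigA2 G) {u : V} (hu : deg G u ≤ 8)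
    (hu2 : deg G u ≠ 2) (v : {v : V | deg G v ≠ 2}) (huv : G.Adj u v) :
    deg (G.induce {v : V | deg G v ≠ 2}) v = deg G v ∨
      10 ≤ deg (G.induce {v : V | deg G v ≠ 2}) v := by
  have hsum := deg_induce_add_nDegEq_two v
  have hle := nDegEq_two_add_ten_le hA2 huv.symm hu hu2
  omega

theorem four_le_deg_of_adj (h2 : TwoConnected G) (hA1 : ¬ ConfigA1 G) (hA3 : ¬ ConfigA3 G)
    {u v : V} (hu : deg G u ≤ 8) (huv : G.Adj u v) : 4 ≤ deg G v := by
  have h0 : deg G v ≠ 0 := ((Set.ncard_pos (Set.toFinite _)).2 ⟨u, huv.symm⟩).ne'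
  have h1 := h2.deg_ne_one v
  have h2' : deg G v ≠ 2 := fun h => by
    have hempty := nDegEq_two_eq_zero_of_deg_le_nine hA1 (hu.trans (by decide))
    rw [nDegEq, Set.ncard_eq_zero] at hempty
    exact Set.eq_empty_iff_forall_notMem.1 hempty v ⟨huv, h⟩
  have h3 : deg G v ≠ 3 := fun h => hA3 ⟨v, u, huv.symm, h, Or.inl hu⟩
  omega

end

theorem claim_four_vertex {V : Type*} [Fintype V] (G : SimpleGraph V)
    (h2 : TwoConnected G) (hplanar : IsPlanar G) (hΔ : 5 ≤ maxDeg G)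
    (hA1 : ¬ ConfigA1 G) (hA2 : ¬ ConfigA2 G) (hA3 : ¬ ConfigA3 G) (hA4 : ¬ ConfigA4 G) :
    ∀ u : ↥{v : V | deg G v ≠ 2}, deg G ↑u = 4 →
      (1 ≤ nDegLe G ↑u 7 →
        {w | w ∈ (G.induce {v : V | deg G v ≠ 2}).neighborSet u ∧
          10 ≤ deg (G.induce {v : V | deg G v ≠ 2}) w}.ncard = 3) ∧
      (nDegLe G ↑u 7 = 0 →
        {w | w ∈ (G.induce {v : V | deg G v ≠ 2}).neighborSet u ∧
          8 ≤ deg (G.induce {v : V | deg G v ≠ 2}) w}.ncard = 4) := by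
  intro u hu
  have hadj {w : V} (huw : G.Adj u w) := four_le_deg_of_adj h2 hA1 hA3 (by omega) huw
  have hH := deg_induce_eq_or_ten_le hA2 (by omega) u.2
  constructor
  · intro hle
    obtain ⟨a, b, c, d, hN, hne, hab, hbc, hcd⟩ := Set.exists_sorted_of_ncard_eq_four (deg G) hu
    have hmem (w : V) : G.Adj u w ↔ w = a ∨ w = b ∨ w = c ∨ w = d := Set.ext_iff.1 hN w
    have ha : G.Adj u a := (hmem a).2 (by simp)
    have hb : G.Adj u b := (hmem b).2 (by simp)
    have hc : G.Adj u c := (hmem c).2 (by simp)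
    have hd : G.Adj u d := (hmem d).2 (by simp)
    have ha4 := hadj ha
    have ha7 : deg G a ≤ 7 := by
      obtain ⟨w, hw, hw7⟩ := (Set.ncard_pos (Set.toFinite _)).1 hle
      rcases (hmem w).1 hw with rfl | rfl | rfl | rfl <;> omega
    have hb11 : 18 ≤ deg G a + deg G b := by
      by_contra! h
      exact hA4 (Or.inl ⟨u, a, b, c, d, hu, ha, hb, hc, hd, hne, hab, hbc, hcd, ha4, ha7,
        by omega⟩)
    rw [← Set.ncard_image_of_injective _ Subtype.val_injective, Set.ncard_eq_three]
    simp only [List.pairwise_cons, List.mem_cons, List.not_mem_nil, or_false, forall_eq_or_imp,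
      forall_eq] at hne
    refine ⟨b, c, d, hne.2.1.1, hne.2.1.2, hne.2.2.1, Set.ext fun w => ⟨?_, fun hw => ?_⟩⟩
    · rintro ⟨x, ⟨hux, hx⟩, rfl⟩
      refine ((hmem x).1 hux).resolve_left fun hxa => ?_
      have hsum := deg_induce_add_nDegEq_two x
      rw [hxa] at hsum
      omega
    · have huw : G.Adj u w := (hmem w).2 (Or.inr hw)
      have hw11 : 11 ≤ deg G w := by rcases hw with rfl | rfl | rfl <;> omega
      have hx := hH ⟨w, show deg G w ≠ 2 by omega⟩ huw
      exact ⟨⟨w, show deg G w ≠ 2 by omega⟩, ⟨huw, by dsimp only at hx; omega⟩, rfl⟩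
  · intro hle
    rw [← hu, deg, ← Set.ncard_image_of_injective _ Subtype.val_injective]
    congr 1
    ext w
    refine ⟨fun ⟨x, hx, hxw⟩ => hxw ▸ hx.1, fun huw => ?_⟩
    have hw8 : ¬ deg G w ≤ 7 := fun h =>
      Set.eq_empty_iff_forall_notMem.1 ((Set.ncard_eq_zero (Set.toFinite _)).1 hle) w ⟨huw, h⟩
    have hx := hH ⟨w, show deg G w ≠ 2 by omega⟩ huw
    exact ⟨⟨w, show deg G w ≠ 2 by omega⟩, ⟨huw, by dsimp only at hx; omega⟩, rfl⟩
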